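/- arXiv:2011.07490 — 6 statements merged into one kernel-verified Lean document; each statement's English description precedes it below -/
import Mathlib

section
/- For every integer n ≥ 2, the map F_n is strictly monotone: for all T, S ∈ ℝ^{d×d} with T ≠ S one has (T − S) : (F_n(T) − F_n(S)) > 0; in particular F_n is injective. -/
open scoped RealInnerProductSpace

/-- `F(T) = (1 + |T|^a)^{-1/a} T` on `ℝ^{d×d}`, realised as the Euclidean space
`EuclideanSpace ℝ (Fin d × Fin d)` (Frobenius norm and inner product). -/
noncomputable def matF (d : ℕ) (a : ℝ) (T : EuclideanSpace ℝ (Fin d × Fin d)) :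
    EuclideanSpace ℝ (Fin d × Fin d) :=
  ((1 + ‖T‖ ^ a) ^ (-(1 / a))) • T

/-- The regularised map `F_n(T) = F(T) + T / (n (1 + |T|^{1 - 1/n}))`. -/
noncomputable def matFn (d : ℕ) (a : ℝ) (n : ℕ) (T : EuclideanSpace ℝ (Fin d × Fin d)) :
    EuclideanSpace ℝ (Fin d × Fin d) :=
  matF d a T + ((n : ℝ) * (1 + ‖T‖ ^ (1 - 1 / (n : ℝ))))⁻¹ • T

/-- A radial map `x ↦ g ‖x‖ • x` with positive `g` and strictly increasing profile `r ↦ g r * r`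
on `[0, ∞)` is strictly monotone. -/
theorem inner_sub_radial_sub_pos {E : Type*} [NormedAddCommGroup E] [InnerProductSpace ℝ E]
    {g : ℝ → ℝ} (hg : ∀ r, 0 ≤ r → 0 < g r) (hmono : StrictMonoOn (fun r => g r * r) (Set.Ici 0))
    {x y : E} (hxy : x ≠ y) : 0 < ⟪x - y, g ‖x‖ • x - g ‖y‖ • y⟫ := by
  have hx := hg _ (norm_nonneg x)
  have hy := hg _ (norm_nonneg y)
  have expand : ⟪x - y, g ‖x‖ • x - g ‖y‖ • y⟫ =
      g ‖x‖ * ‖x‖ ^ 2 + g ‖y‖ * ‖y‖ ^ 2 - (g ‖x‖ + g ‖y‖) * ⟪x, y⟫ := by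
    simp only [inner_sub_left, inner_sub_right, real_inner_smul_right,
      real_inner_self_eq_norm_sq, real_inner_comm x y]
    ring
  rcases eq_or_ne ‖x‖ ‖y‖ with h | h
  · have hpos : 0 < ‖x - y‖ ^ 2 := pow_pos (norm_pos_iff.2 (sub_ne_zero.2 hxy)) 2
    rw [h, ← smul_sub, real_inner_smul_right, real_inner_self_eq_norm_sq]
    exact mul_pos hy hpos
  · have cauchy := mul_le_mul_of_nonneg_left (real_inner_le_norm x y) (add_pos hx hy).le
    have hpos : 0 < (‖x‖ - ‖y‖) * (g ‖x‖ * ‖x‖ - g ‖y‖ * ‖y‖) := by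
      rcases h.lt_or_gt with h | h
      · exact mul_pos_of_neg_of_neg (sub_neg.2 h)
          (sub_neg.2 (hmono (norm_nonneg x) (norm_nonneg y) h))
      · exact mul_pos (sub_pos.2 h) (sub_pos.2 (hmono (norm_nonneg y) (norm_nonneg x) h))
    rw [expand]
    linarith

theorem monotoneOn_one_add_rpow_rpow_mul {a : ℝ} (ha : 0 < a) :
    MonotoneOn (fun r : ℝ => (1 + r ^ a) ^ (-(1 / a)) * r) (Set.Ici 0) := by
  intro r hr s hs hrs
  have hr : 0 ≤ r := hr
  have hs : 0 ≤ s := hs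
  have hra := Real.rpow_nonneg hr a
  have hsa := Real.rpow_nonneg hs a
  have hle : r ^ a ≤ s ^ a := Real.rpow_le_rpow hr hrs ha.le
  have key : ((1 + s ^ a) * r ^ a) ^ (1 / a) ≤ ((1 + r ^ a) * s ^ a) ^ (1 / a) :=
    Real.rpow_le_rpow (by positivity) (by linarith) (by positivity)
  rw [Real.mul_rpow (by positivity) hra, Real.mul_rpow (by positivity) hsa, one_div,
    Real.rpow_rpow_inv hr ha.ne', Real.rpow_rpow_inv hs ha.ne'] at key
  have hR : 0 < (1 + r ^ a) ^ a⁻¹ := by positivity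
  have hS : 0 < (1 + s ^ a) ^ a⁻¹ := by positivity
  simp only [one_div]
  rw [Real.rpow_neg (by positivity), Real.rpow_neg (by positivity), inv_mul_eq_div,
    inv_mul_eq_div, div_le_div_iff₀ hR hS]
  linarith

theorem strictMonoOn_inv_one_add_rpow_mul {c b : ℝ} (hc : 0 < c) (hb₀ : 0 ≤ b) (hb₁ : b ≤ 1) :
    StrictMonoOn (fun r : ℝ => (c * (1 + r ^ b))⁻¹ * r) (Set.Ici 0) := by
  intro r hr s hs hrs
  have hr : 0 ≤ r := hr
  have hs : 0 ≤ s := hs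
  have hrb := Real.rpow_nonneg hr b
  have hsb := Real.rpow_nonneg hs b
  have split : ∀ {t : ℝ}, 0 ≤ t → t ^ b * t ^ (1 - b) = t := fun {t} ht => by
    rw [← Real.rpow_add_of_nonneg ht hb₀ (sub_nonneg.2 hb₁), add_sub_cancel, Real.rpow_one]
  have key : r * s ^ b ≤ s * r ^ b := by
    calc r * s ^ b = r ^ b * s ^ b * r ^ (1 - b) := by rw [mul_right_comm, split hr]
      _ ≤ r ^ b * s ^ b * s ^ (1 - b) := by
        gcongr
      _ = s * r ^ b := by rw [mul_assoc, split hs, mul_comm]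
  simp only
  rw [inv_mul_eq_div, inv_mul_eq_div, div_lt_div_iff₀ (by positivity) (by positivity)]
  have := mul_lt_mul_of_pos_left (add_lt_add_of_lt_of_le hrs key) hc
  linarith

/-- For every integer `n ≥ 2`, the map `F_n` is strictly monotone:
for all `T ≠ S`, `(T − S) : (F_n(T) − F_n(S)) > 0`; in particular `F_n` is injective. -/
theorem stmt_4 {d : ℕ} (hd : 1 ≤ d) {a : ℝ} (ha : 0 < a) (n : ℕ) (hn : 2 ≤ n) :
    (∀ T S : EuclideanSpace ℝ (Fin d × Fin d), T ≠ S →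
      0 < ⟪T - S, matFn d a n T - matFn d a n S⟫) ∧
    Function.Injective (matFn d a n) := by
  have hn₀ : (0 : ℝ) < n := by exact_mod_cast (by omega : 0 < n)
  have hn₁ : 1 / (n : ℝ) ≤ 1 := by
    rw [div_le_one hn₀]
    exact_mod_cast (by omega : 1 ≤ n)
  let g : ℝ → ℝ := fun r =>
    (1 + r ^ a) ^ (-(1 / a)) + ((n : ℝ) * (1 + r ^ (1 - 1 / (n : ℝ))))⁻¹
  have hg : ∀ r, 0 ≤ r → 0 < g r := fun r hr => by
    simp only [g]
    positivity
  have hmono : StrictMonoOn (fun r => g r * r) (Set.Ici 0) := by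
    simp only [g, add_mul _ _ (_ : ℝ)]
    exact (monotoneOn_one_add_rpow_rpow_mul ha).add_strictMono
      (strictMonoOn_inv_one_add_rpow_mul hn₀ (sub_nonneg.2 hn₁) (sub_le_self _ (by positivity)))
  have hF : ∀ T, matFn d a n T = g ‖T‖ • T := fun T => (add_smul _ _ T).symm
  have hpos : ∀ T S : EuclideanSpace ℝ (Fin d × Fin d), T ≠ S →
      0 < ⟪T - S, matFn d a n T - matFn d a n S⟫ := fun T S hTS => by
    rw [hF, hF]
    exact inner_sub_radial_sub_pos hg hmono hTS
  refine ⟨hpos, fun T S h => ?_⟩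
  by_contra hTS
  simpa [h] using hpos T S hTS
end

section
/- For every integer n ≥ 2, the map F_n is a C¹-diffeomorphism of ℝ^{d×d} onto itself: F_n is continuously differentiable, bijective, and its inverse F_n^{−1} is continuously differentiable. -/
open Filter Topology Set Asymptotics

/-- A bijective `C¹` self-map of a finite-dimensional space with injective differentials has a
`C¹` inverse. -/
theorem contDiff_one_invFun_of_bijective {E : Type*} [NormedAddCommGroup E] [NormedSpace ℝ E]
    [FiniteDimensional ℝ E] {f : E → E} {f' : E → E →L[ℝ] E} (hf : ContDiff ℝ 1 f)
    (hbij : Function.Bijective f) (hf' : ∀ x, HasFDerivAt f (f' x) x)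
    (hinj : ∀ x, Function.Injective (f' x)) : ContDiff ℝ 1 (Function.invFun f) := by
  have := FiniteDimensional.complete ℝ E
  rw [contDiff_iff_contDiffAt]
  intro y
  obtain ⟨x, rfl⟩ := hbij.2 y
  set e : E ≃L[ℝ] E :=
    (LinearEquiv.ofInjectiveEndo (f' x : E →ₗ[ℝ] E) (hinj x)).toContinuousLinearEquiv
  have he : HasFDerivAt f (e : E →L[ℝ] E) x := by
    convert hf' x using 1
    ext v
    rfl
  refine (hf.contDiffAt.to_localInverse he one_ne_zero).congr_of_eventuallyEq ?_
  filter_upwards [(hf.contDiffAt.hasStrictFDerivAt' he one_ne_zero).eventually_right_inverse]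
    with z hz
  exact hbij.1 ((Function.invFun_eq (hbij.2 z)).trans hz.symm)

section Radial

variable {E : Type*} [NormedAddCommGroup E] [InnerProductSpace ℝ E] {φ ψ : ℝ → ℝ}

/-- The differential of `x ↦ φ ‖x‖ • x`, where `ψ r = r * φ' r`. -/
noncomputable def radialFDeriv (φ ψ : ℝ → ℝ) (x : E) : E →L[ℝ] E :=
  φ ‖x‖ • ContinuousLinearMap.id ℝ E + (ψ ‖x‖ / ‖x‖ ^ 2) • (innerSL ℝ x).smulRight x

theorem radialFDeriv_apply (φ ψ : ℝ → ℝ) (x v : E) :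
    radialFDeriv φ ψ x v = φ ‖x‖ • v + (ψ ‖x‖ / ‖x‖ ^ 2) • inner ℝ x v • x := by
  simp [radialFDeriv]

theorem hasFDerivAt_norm_of_ne_zero {x : E} (hx : x ≠ 0) :
    HasFDerivAt (fun y : E => ‖y‖) (‖x‖⁻¹ • innerSL ℝ x) x := by
  have h := (hasStrictFDerivAt_norm_sq x).hasFDerivAt.sqrt (by simpa using hx)
  simp only [Real.sqrt_sq (norm_nonneg _)] at h
  convert h using 1
  ext v
  simp
  field_simp

theorem hasFDerivAt_radial (hφ : ContinuousOn φ (Ici 0))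
    (hφ' : ∀ r, 0 < r → HasDerivAt φ (ψ r / r) r) (x : E) :
    HasFDerivAt (fun y : E => φ ‖y‖ • y) (radialFDeriv φ ψ x) x := by
  rcases eq_or_ne x 0 with rfl | hx
  · have hcont : Continuous fun y : E => φ ‖y‖ :=
      hφ.comp_continuous continuous_norm fun y => norm_nonneg y
    have h0 : (fun y : E => φ ‖y‖ - φ 0) =o[𝓝 0] fun _ => (1 : ℝ) := by
      rw [isLittleO_one_iff]
      refine tendsto_sub_nhds_zero_iff.2 ?_
      simpa only [norm_zero] using hcont.tendsto (0 : E)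
    have h1 := h0.smul_isBigO (isBigO_refl (fun y : E => y) (𝓝 0))
    rw [hasFDerivAt_iff_isLittleO]
    refine (h1.congr_left fun y => ?_).congr_right fun y => ?_
    · simp [radialFDeriv_apply, sub_smul]
    · simp
  · have hpos := norm_pos_iff.2 hx
    have h := ((hφ' _ hpos).comp_hasFDerivAt x (hasFDerivAt_norm_of_ne_zero hx)).smul
      (hasFDerivAt_id x)
    refine h.congr_fderiv (ContinuousLinearMap.ext fun v => ?_)
    rw [radialFDeriv_apply]
    simp only [Function.comp_apply, add_apply, smul_apply,
      ContinuousLinearMap.smulRight_apply, ContinuousLinearMap.id_apply, innerSL_apply_apply, id,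
      smul_eq_mul, smul_smul]
    congr 2
    field_simp

theorem continuous_radialFDeriv (hφ : ContinuousOn φ (Ici 0)) (hψ : ContinuousOn ψ (Ici 0))
    (hψ0 : ψ 0 = 0) : Continuous (radialFDeriv φ ψ : E → E →L[ℝ] E) := by
  have hφc : Continuous fun y : E => φ ‖y‖ :=
    hφ.comp_continuous continuous_norm fun y => norm_nonneg y
  have hψc : Continuous fun y : E => ψ ‖y‖ :=
    hψ.comp_continuous continuous_norm fun y => norm_nonneg y
  refine (hφc.smul continuous_const).add ?_
  rw [continuous_iff_continuousAt]
  intro x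
  rcases eq_or_ne x 0 with rfl | hx
  · have h : Tendsto (fun y : E => |ψ ‖y‖|) (𝓝 0) (𝓝 0) := by
      simpa [hψ0] using hψc.abs.tendsto (0 : E)
    rw [ContinuousAt]
    simp only [norm_zero, map_zero, ContinuousLinearMap.smulRight_zero, smul_zero]
    refine squeeze_zero_norm (fun y => ?_) h
    rw [norm_smul, ContinuousLinearMap.norm_smulRight_apply, innerSL_apply_norm, norm_div,
      norm_pow, norm_norm, Real.norm_eq_abs, ← sq]
    rcases eq_or_ne y 0 with rfl | hy
    · simp
    · rw [div_mul_cancel₀ _ (by simpa using hy)]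
  · have hs : Continuous fun y : E => (innerSL ℝ y).smulRight y := by fun_prop
    exact (hψc.continuousAt.div (by fun_prop) (by simpa using hx)).smul hs.continuousAt

theorem injective_radialFDeriv (hφ : ∀ r, 0 ≤ r → 0 < φ r) (hφψ : ∀ r, 0 < r → 0 < φ r + ψ r)
    (x : E) : Function.Injective (radialFDeriv φ ψ x) := by
  rw [injective_iff_map_eq_zero]
  intro v hv
  rw [radialFDeriv_apply] at hv
  have hinner : inner ℝ x v • x = 0 := by
    rcases eq_or_ne x 0 with rfl | hx
    · simp
    · have hpos := norm_pos_iff.2 hx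
      have h := congrArg (inner ℝ x) hv
      simp only [inner_add_right, inner_smul_right, real_inner_self_eq_norm_sq,
        inner_zero_right] at h
      have h' : (φ ‖x‖ + ψ ‖x‖) * inner ℝ x v = 0 := by
        rw [← h]
        field_simp
      rw [(mul_eq_zero.1 h').resolve_left (hφψ _ hpos).ne', zero_smul]
  rw [hinner, smul_zero, add_zero] at hv
  exact (smul_eq_zero.1 hv).resolve_left (hφ _ (norm_nonneg x)).ne'

theorem bijective_radial (hφc : ContinuousOn φ (Ici 0))
    (hφ' : ∀ r, 0 < r → HasDerivAt φ (ψ r / r) r) (hφ : ∀ r, 0 ≤ r → 0 < φ r)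
    (hφψ : ∀ r, 0 < r → 0 < φ r + ψ r) (htop : Tendsto (fun r => φ r * r) atTop atTop) :
    Function.Bijective fun x : E => φ ‖x‖ • x := by
  have hcont : ContinuousOn (fun r => φ r * r) (Ici 0) := hφc.mul continuousOn_id
  have hmono : StrictMonoOn (fun r => φ r * r) (Ici 0) := by
    refine strictMonoOn_of_deriv_pos (convex_Ici 0) hcont fun r hr => ?_
    rw [interior_Ici, mem_Ioi] at hr
    have h := (hφ' r hr).mul (hasDerivAt_id r)
    have h' : deriv (fun r => φ r * r) r = φ r + ψ r := by
      refine h.deriv.trans ?_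
      simp only [id]
      field_simp
      ring
    rw [h']
    exact hφψ r hr
  have hnorm (x : E) : ‖φ ‖x‖ • x‖ = φ ‖x‖ * ‖x‖ := by
    rw [norm_smul, Real.norm_of_nonneg (hφ _ (norm_nonneg x)).le]
  constructor
  · intro x y hxy
    have hxy' : φ ‖x‖ • x = φ ‖y‖ • y := hxy
    have h : ‖x‖ = ‖y‖ := hmono.injOn (norm_nonneg x) (norm_nonneg y) (by
      simpa only [hnorm] using congrArg norm hxy')
    rw [h] at hxy'
    exact smul_right_injective E (hφ _ (norm_nonneg y)).ne' hxy'
  · intro y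
    rcases eq_or_ne y 0 with rfl | hy
    · exact ⟨0, by simp⟩
    have hpos := norm_pos_iff.2 hy
    obtain ⟨R, hR0, hR⟩ := ((eventually_ge_atTop 0).and (htop.eventually_ge_atTop ‖y‖)).exists
    obtain ⟨r, hr, hry⟩ := intermediate_value_Icc hR0 (hcont.mono Icc_subset_Ici_self)
      ⟨by simp, hR⟩
    refine ⟨(r / ‖y‖) • y, ?_⟩
    have hn : ‖(r / ‖y‖) • y‖ = r := by
      rw [norm_smul, Real.norm_of_nonneg (div_nonneg hr.1 hpos.le)]
      field_simp
    simp only [hn] at hry ⊢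
    rw [smul_smul, ← mul_div_assoc, hry, div_self hpos.ne', one_smul]

theorem contDiff_one_bijective_radial [FiniteDimensional ℝ E] (hφc : ContinuousOn φ (Ici 0))
    (hψc : ContinuousOn ψ (Ici 0)) (hψ0 : ψ 0 = 0)
    (hφ' : ∀ r, 0 < r → HasDerivAt φ (ψ r / r) r) (hφ : ∀ r, 0 ≤ r → 0 < φ r)
    (hφψ : ∀ r, 0 < r → 0 < φ r + ψ r) (htop : Tendsto (fun r => φ r * r) atTop atTop) :
    ContDiff ℝ 1 (fun x : E => φ ‖x‖ • x) ∧ Function.Bijective (fun x : E => φ ‖x‖ • x) ∧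
      ContDiff ℝ 1 (Function.invFun fun x : E => φ ‖x‖ • x) := by
  have hd := hasFDerivAt_radial (E := E) hφc hφ'
  have hC : ContDiff ℝ 1 fun x : E => φ ‖x‖ • x :=
    contDiff_one_iff_hasFDerivAt.2 ⟨_, continuous_radialFDeriv hφc hψc hψ0, hd⟩
  have hbij := bijective_radial (E := E) hφc hφ' hφ hφψ htop
  exact ⟨hC, hbij, contDiff_one_invFun_of_bijective hC hbij hd (injective_radialFDeriv hφ hφψ)⟩

end Radial

/-- For every integer `n ≥ 2`, the map `F_n` is a
`C¹`-diffeomorphism of `ℝ^{d×d}` onto itself: `F_n` is continuously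
differentiable, bijective, and its inverse is continuously differentiable. -/
theorem stmt_6 {d : ℕ} (hd : 1 ≤ d) {a : ℝ} (ha : 0 < a) (n : ℕ) (hn : 2 ≤ n) :
    ContDiff ℝ 1 (matFn d a n) ∧ Function.Bijective (matFn d a n) ∧
    ContDiff ℝ 1 (Function.invFun (matFn d a n)) := by
  have hn2 : (2 : ℝ) ≤ n := by exact_mod_cast hn
  have hn0 : (0 : ℝ) < n := by linarith
  obtain ⟨b, hb⟩ : ∃ b : ℝ, b = 1 - 1 / (n : ℝ) := ⟨_, rfl⟩
  have hb0 : 0 < b := by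
    have : 1 / (n : ℝ) < 1 := by rw [div_lt_one hn0]; linarith
    linarith
  have hb1 : b < 1 := by
    have : 0 < 1 / (n : ℝ) := by positivity
    linarith
  have hcont {c : ℝ} (hc : 0 < c) : Continuous fun r : ℝ => r ^ c :=
    Real.continuous_rpow_const hc.le
  have h1pos (c : ℝ) {r : ℝ} (hr : 0 ≤ r) : 0 < 1 + r ^ c := by positivity
  set φ : ℝ → ℝ := fun r => (1 + r ^ a) ^ (-(1 / a)) + ((n : ℝ) * (1 + r ^ b))⁻¹ with hφ
  set ψ : ℝ → ℝ := fun r =>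
    -(r ^ a * (1 + r ^ a) ^ (-(1 / a) - 1)) - b * r ^ b / ((n : ℝ) * (1 + r ^ b) ^ 2) with hψ
  have hF : matFn d a n = fun T => φ ‖T‖ • T := by
    ext1 T
    rw [matFn, matF, ← add_smul, ← hb]
  have hpow (c : ℝ) : ContinuousOn (fun r : ℝ => (1 + r ^ a) ^ c) (Ici 0) :=
    (continuous_const.add (hcont ha)).continuousOn.rpow_const
      fun r hr => Or.inl (h1pos a hr).ne'
  have hb' : ContinuousOn (fun r : ℝ => 1 + r ^ b) (Ici 0) :=
    (continuous_const.add (hcont hb0)).continuousOn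
  rw [hF]
  refine contDiff_one_bijective_radial (ψ := ψ) ?_ ?_ ?_ ?_ ?_ ?_ ?_
  · exact (hpow _).add ((continuousOn_const.mul hb').inv₀
      fun r hr => (mul_pos hn0 (h1pos b hr)).ne')
  · exact ((hcont ha).continuousOn.mul (hpow _)).neg.sub
      ((continuousOn_const.mul (hcont hb0).continuousOn).div (continuousOn_const.mul (hb'.pow 2))
        fun r hr => (mul_pos hn0 (pow_pos (h1pos b hr) 2)).ne')
  · simp [hψ, Real.zero_rpow ha.ne', Real.zero_rpow hb0.ne']
  · intro r hr
    have hA := h1pos a hr.le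
    have hB := h1pos b hr.le
    have h1 := ((Real.hasDerivAt_rpow_const (p := a) (Or.inl hr.ne')).const_add 1).rpow_const
      (p := -(1 / a)) (Or.inl hA.ne')
    have h2 := (((Real.hasDerivAt_rpow_const (p := b) (Or.inl hr.ne')).const_add 1).const_mul
      (n : ℝ)).inv (mul_pos hn0 hB).ne'
    refine (h1.add h2).congr_deriv ?_
    rw [Real.rpow_sub_one hr.ne', Real.rpow_sub_one hr.ne']
    simp only [hψ]
    field_simp
    ring
  · intro r hr
    have hA := h1pos a hr
    have hB := h1pos b hr
    positivity
  · intro r hr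
    have hA := h1pos a hr.le
    have hB := h1pos b hr.le
    have hrb : 0 < r ^ b := by positivity
    have h : φ r + ψ r = (1 + r ^ a) ^ (-(1 / a) - 1)
        + (1 + (1 - b) * r ^ b) / ((n : ℝ) * (1 + r ^ b) ^ 2) := by
      have h1 : (1 + r ^ a) ^ (-(1 / a)) = (1 + r ^ a) ^ (-(1 / a) - 1) * (1 + r ^ a) := by
        rw [Real.rpow_sub_one hA.ne']
        field_simp
      simp only [hφ, hψ]
      rw [h1]
      field_simp
      ring
    rw [h]
    have : 0 < 1 - b := by linarith
    positivity
  · have hlim : Tendsto (fun r : ℝ => (2 * (n : ℝ))⁻¹ * r ^ (1 - b)) atTop atTop :=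
      (tendsto_rpow_atTop (by linarith)).const_mul_atTop (by positivity)
    refine tendsto_atTop_mono' _ ?_ hlim
    filter_upwards [eventually_ge_atTop 1] with r hr
    have hr0 : 0 < r := by linarith
    have hA := h1pos a hr0.le
    have hrb : 1 ≤ r ^ b := Real.one_le_rpow hr hb0.le
    calc (2 * (n : ℝ))⁻¹ * r ^ (1 - b) = ((n : ℝ) * (r ^ b + r ^ b))⁻¹ * r := by
          rw [Real.rpow_sub hr0, Real.rpow_one]
          field_simp
          norm_num
      _ ≤ ((n : ℝ) * (1 + r ^ b))⁻¹ * r := by gcongr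
      _ ≤ φ r * r := by
          gcongr
          exact le_add_of_nonneg_left (by positivity)
end

section
/- Let l ≥ 1 and let f : ℝ^l → ℝ^l be a C¹ map. Then f is a C¹-diffeomorphism of ℝ^l onto itself if and only if the Jacobian determinant det(Df(v)) is nonzero for every v ∈ ℝ^l and |f(v)| → ∞ whenever |v| → ∞ (i.e., f is proper in the sense that the preimage of every bounded set is bounded). -/
open Filter Topology

section Topological

variable {E X : Type*} [TopologicalSpace E] [TopologicalSpace X]

/-- A proper local homeomorphism from a Hausdorff space is a covering map. -/
theorem IsLocalHomeomorph.isCoveringMap_of_isProperMap [T2Space E]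
    {f : E → X} (hf : IsLocalHomeomorph f) (hp : IsProperMap f) : IsCoveringMap f := by
  rw [isCoveringMap_iff_isCoveringMapOn_univ]
  refine hp.isClosedMap.isCoveringMapOn_of_isLocalHomeomorphOn (fun x _ ↦ ?_) ?_
  · refine (hp.isCompact_preimage isCompact_singleton).finite
      (IsDiscrete.of_openPartialHomeomorph f subset_rfl fun e _ ↦ ?_)
    obtain ⟨φ, hφ, rfl⟩ := hf e
    exact ⟨φ, hφ, rfl⟩
  · simpa [← isLocalHomeomorph_iff_isLocalHomeomorphOn_univ] using hf

/-- A covering map from a connected space to a simply connected, locally path-connected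
space is bijective. -/
theorem IsCoveringMap.bijective_of_simplyConnectedSpace [ConnectedSpace E]
    [SimplyConnectedSpace X] [LocallyPathConnectedSpace X] {f : E → X} (hf : IsCoveringMap f) :
    Function.Bijective f := by
  obtain ⟨e⟩ := (inferInstance : Nonempty E)
  obtain ⟨g, ⟨hge, hfg⟩, -⟩ :=
    hf.existsUnique_continuousMap_lifts (ContinuousMap.id X) (f e) e rfl
  have hfg' (x : X) : f (g x) = x := congrFun hfg x
  have hgf : g ∘ f = id :=
    hf.eq_of_comp_eq (g.continuous.comp hf.continuous) continuous_id
      (funext fun x ↦ hfg' (f x)) e hge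
  exact ⟨Function.LeftInverse.injective (congrFun hgf), Function.RightInverse.surjective hfg'⟩

end Topological

section Calculus

variable {E : Type*} [NormedAddCommGroup E] [NormedSpace ℝ E]

theorem ContDiff.isLocalHomeomorph_of_hasFDerivAt_equiv [CompleteSpace E] {f : E → E}
    (hf : ContDiff ℝ 1 f) (h : ∀ v, ∃ A : E ≃L[ℝ] E, HasFDerivAt f (A : E →L[ℝ] E) v) :
    IsLocalHomeomorph f := by
  intro v
  obtain ⟨A, hA⟩ := h v
  exact ⟨hf.contDiffAt.toOpenPartialHomeomorph f hA one_ne_zero,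
    hf.contDiffAt.mem_toOpenPartialHomeomorph_source hA one_ne_zero, rfl⟩

theorem det_fderiv_ne_zero_of_leftInverse {f g : E → E} (hf : Differentiable ℝ f)
    (hg : Differentiable ℝ g) (hgf : Function.LeftInverse g f) (v : E) :
    LinearMap.det (fderiv ℝ f v : E →ₗ[ℝ] E) ≠ 0 := by
  have hcomp : (fderiv ℝ g (f v)).comp (fderiv ℝ f v) = ContinuousLinearMap.id ℝ E := by
    rw [← fderiv_comp v (hg _) (hf v), hgf.comp_eq_id, fderiv_id]
  have hdet := congrArg (fun A : E →L[ℝ] E ↦ LinearMap.det (A : E →ₗ[ℝ] E)) hcomp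
  simp only [ContinuousLinearMap.toLinearMap_comp, LinearMap.det_comp,
    ContinuousLinearMap.coe_id, LinearMap.det_id] at hdet
  exact right_ne_zero_of_mul_eq_one hdet

theorem tendsto_norm_comap_atTop_iff_isProperMap [FiniteDimensional ℝ E] {f : E → E}
    (hf : Continuous f) :
    Tendsto (fun v ↦ ‖f v‖) (comap (fun v : E ↦ ‖v‖) atTop) atTop ↔ IsProperMap f := by
  have : ProperSpace E := FiniteDimensional.proper ℝ E
  rw [isProperMap_iff_tendsto_cocompact, and_iff_right hf, ← Metric.cobounded_eq_cocompact,
    ← comap_norm_atTop, tendsto_comap_iff]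
  rfl

end Calculus

/-- **Hadamard's global inverse function criterion.** Let `l ≥ 1` and
let `f : ℝ^l → ℝ^l` be a `C¹` map. Then `f` is a `C¹`-diffeomorphism of `ℝ^l` onto
itself (i.e. bijective with `C¹` inverse) if and only if the Jacobian determinant
`det (Df(v))` is nonzero for every `v` and `|f(v)| → ∞` whenever `|v| → ∞`. -/
theorem stmt_7 {l : ℕ} (hl : 1 ≤ l)
    (f : EuclideanSpace ℝ (Fin l) → EuclideanSpace ℝ (Fin l))
    (hf : ContDiff ℝ 1 f) :
    (Function.Bijective f ∧ ContDiff ℝ 1 (Function.invFun f)) ↔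
      ((∀ v : EuclideanSpace ℝ (Fin l),
          LinearMap.det ((fderiv ℝ f v : EuclideanSpace ℝ (Fin l) →L[ℝ]
            EuclideanSpace ℝ (Fin l)) :
            EuclideanSpace ℝ (Fin l) →ₗ[ℝ] EuclideanSpace ℝ (Fin l)) ≠ 0) ∧
        Filter.Tendsto (fun v => ‖f v‖)
          (Filter.comap (fun v : EuclideanSpace ℝ (Fin l) => ‖v‖) Filter.atTop)
          Filter.atTop) := by
  rw [tendsto_norm_comap_atTop_iff_isProperMap hf.continuous]
  constructor
  · rintro ⟨hbij, hinv⟩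
    have hleft := Function.leftInverse_invFun hbij.injective
    have hright := Function.rightInverse_invFun hbij.surjective
    let e : EuclideanSpace ℝ (Fin l) ≃ₜ EuclideanSpace ℝ (Fin l) :=
      { toFun := f
        invFun := Function.invFun f
        left_inv := hleft
        right_inv := hright
        continuous_toFun := hf.continuous
        continuous_invFun := hinv.continuous }
    exact ⟨det_fderiv_ne_zero_of_leftInverse (hf.differentiable one_ne_zero)
      (hinv.differentiable one_ne_zero) hleft, e.isProperMap⟩
  · rintro ⟨hdet, hproper⟩
    have hderiv (v : EuclideanSpace ℝ (Fin l)) :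
        ∃ A : EuclideanSpace ℝ (Fin l) ≃L[ℝ] EuclideanSpace ℝ (Fin l),
          HasFDerivAt f (A : EuclideanSpace ℝ (Fin l) →L[ℝ] EuclideanSpace ℝ (Fin l)) v := by
      refine ⟨(fderiv ℝ f v).toContinuousLinearEquivOfDetNeZero (hdet v), ?_⟩
      rw [ContinuousLinearMap.coe_toContinuousLinearEquivOfDetNeZero]
      exact (hf.differentiable one_ne_zero v).hasFDerivAt
    have hlocal := hf.isLocalHomeomorph_of_hasFDerivAt_equiv hderiv
    have hbij :=
      (hlocal.isCoveringMap_of_isProperMap hproper).bijective_of_simplyConnectedSpace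
    refine ⟨hbij, ?_⟩
    let e := hlocal.toHomeomorphOfBijective hbij
    have hinv : Function.invFun f = e.symm := by
      funext y
      apply hbij.injective
      rw [Function.rightInverse_invFun hbij.surjective y]
      exact (e.apply_symm_apply y).symm
    choose A hA using hderiv
    rw [hinv]
    exact e.contDiff_symm hA hf
end

section
/- Assume a ≠ 1. There exist positive constants c_a and C_a depending only on a such that for every integer n ≥ 2 and every s ≥ 0: c_a (s^{(1−a)/2} 𝟙_{s ≥ 1} − 1) ≤ h_n(s) ≤ C_a (s^{1/n} + s^{(1−a)/2} 𝟙_{s ≥ 1} + 1), where 𝟙_{s ≥ 1} equals 1 if s ≥ 1 and 0 otherwise. -/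
/-- The function `h_n(s)` of the paper, defined for an integer `n` by the integral
`h_n(s) = ∫₀^s [ (1+t^{a/2})^{-1-1/a} + 1/(n²(1+t^{1/2-1/(2n)})²)
                 + (1-1/n)/(n(1+t^{1/2-1/(2n)})²) ] dt`. -/
noncomputable def hfun (a : ℝ) (n : ℕ) (s : ℝ) : ℝ :=
  ∫ t in (0 : ℝ)..s,
    ((1 + t ^ (a / 2)) ^ (-(1 + 1 / a)) +
      1 / ((n : ℝ) ^ 2 * (1 + t ^ (1 / 2 - 1 / (2 * (n : ℝ)))) ^ 2) +
      (1 - 1 / (n : ℝ)) * (1 / ((n : ℝ) * (1 + t ^ (1 / 2 - 1 / (2 * (n : ℝ)))) ^ 2)))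

theorem continuousOn_one_add_rpow_rpow {a : ℝ} (ha : 0 < a) (q : ℝ) :
    ContinuousOn (fun t : ℝ => (1 + t ^ (a / 2)) ^ q) (Set.Ici 0) := by
  refine ContinuousOn.rpow_const ?_ fun t ht => Or.inl ?_
  · exact continuousOn_const.add
      (continuousOn_id.rpow_const fun t _ => Or.inr (by positivity))
  · have := Real.rpow_nonneg (Set.mem_Ici.1 ht) (a / 2)
    positivity

theorem continuousOn_inv_one_add_rpow_sq {b : ℝ} (hb : 0 ≤ b) :
    ContinuousOn (fun t : ℝ => 1 / (1 + t ^ b) ^ 2) (Set.Ici 0) := by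
  refine continuousOn_const.div ?_ fun t ht => ?_
  · exact (continuousOn_const.add
      (continuousOn_id.rpow_const fun t _ => Or.inr hb)).pow 2
  · have := Real.rpow_nonneg (Set.mem_Ici.1 ht) b
    positivity

theorem intervalIntegrable_of_continuousOn_Ici {f : ℝ → ℝ} (hf : ContinuousOn f (Set.Ici 0))
    {x y : ℝ} (hx : 0 ≤ x) (hy : 0 ≤ y) : IntervalIntegrable f MeasureTheory.volume x y :=
  (hf.mono fun _ ht => (le_min hx hy).trans ht.1).intervalIntegrable

/-- The two rational terms of the integrand of `hfun` combine into one. -/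
theorem hfun_eq_add {a : ℝ} (ha : 0 < a) {n : ℕ} (hn : 2 ≤ n) {s : ℝ} (hs : 0 ≤ s) :
    hfun a n s = (∫ t in (0 : ℝ)..s, (1 + t ^ (a / 2)) ^ (-(1 + 1 / a))) +
      ∫ t in (0 : ℝ)..s,
        (1 / (n : ℝ)) * (1 / (1 + t ^ (1 / 2 - 1 / (2 * (n : ℝ)))) ^ 2) := by
  have hn' : (2 : ℝ) ≤ n := by exact_mod_cast hn
  have hb : (0 : ℝ) ≤ 1 / 2 - 1 / (2 * (n : ℝ)) := by
    rw [sub_nonneg]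
    exact one_div_le_one_div_of_le (by norm_num) (by linarith)
  have hr : IntervalIntegrable
      (fun t : ℝ => (1 / (n : ℝ)) * (1 / (1 + t ^ (1 / 2 - 1 / (2 * (n : ℝ)))) ^ 2))
      MeasureTheory.volume 0 s :=
    (intervalIntegrable_of_continuousOn_Ici (continuousOn_inv_one_add_rpow_sq hb)
      le_rfl hs).const_mul _
  rw [← intervalIntegral.integral_add
    (intervalIntegrable_of_continuousOn_Ici (continuousOn_one_add_rpow_rpow ha _) le_rfl hs) hr]
  refine intervalIntegral.integral_congr fun t ht => ?_
  rw [Set.uIcc_of_le hs] at ht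
  have hpos : 0 < 1 + t ^ (1 / 2 - 1 / (2 * (n : ℝ))) := by
    have := Real.rpow_nonneg ht.1 (1 / 2 - 1 / (2 * (n : ℝ)))
    positivity
  have hn0 : (n : ℝ) ≠ 0 := by positivity
  generalize 1 + t ^ (1 / 2 - 1 / (2 * (n : ℝ))) = D at hpos
  field_simp
  ring

theorem integral_rational_term_nonneg (n : ℕ) {s : ℝ} (hs : 0 ≤ s) :
    0 ≤ ∫ t in (0 : ℝ)..s,
        (1 / (n : ℝ)) * (1 / (1 + t ^ (1 / 2 - 1 / (2 * (n : ℝ)))) ^ 2) :=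
  intervalIntegral.integral_nonneg hs fun _ _ => by positivity

theorem integral_rational_term_le {n : ℕ} (hn : 2 ≤ n) {s : ℝ} (hs : 0 ≤ s) :
    ∫ t in (0 : ℝ)..s,
        (1 / (n : ℝ)) * (1 / (1 + t ^ (1 / 2 - 1 / (2 * (n : ℝ)))) ^ 2) ≤ s ^ (1 / (n : ℝ)) := by
  have hn' : (2 : ℝ) ≤ n := by exact_mod_cast hn
  have hn0 : (n : ℝ) ≠ 0 := by positivity
  have hinv : 0 < 1 / (n : ℝ) := by positivity
  have hb : (0 : ℝ) ≤ 1 / 2 - 1 / (2 * (n : ℝ)) := by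
    rw [sub_nonneg]
    exact one_div_le_one_div_of_le (by norm_num) (by linarith)
  have hint : ∫ t in (0 : ℝ)..s, (1 / (n : ℝ)) * t ^ (1 / (n : ℝ) - 1) = s ^ (1 / (n : ℝ)) := by
    rw [intervalIntegral.integral_const_mul, integral_rpow (Or.inl (by linarith)),
      sub_add_cancel, Real.zero_rpow hinv.ne', sub_zero]
    field_simp
  rw [← hint]
  refine intervalIntegral.integral_mono_on_of_le_Ioo hs
    (intervalIntegrable_of_continuousOn_Ici
      (continuousOn_const.mul (continuousOn_inv_one_add_rpow_sq hb)) le_rfl hs)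
    ((intervalIntegral.intervalIntegrable_rpow' (by linarith)).const_mul _) fun t ht => ?_
  have ht0 : 0 < t := ht.1
  have hp : 0 < t ^ (1 / 2 - 1 / (2 * (n : ℝ))) := Real.rpow_pos_of_pos ht0 _
  have hsq : t ^ (1 / (n : ℝ) - 1) = 1 / (t ^ (1 / 2 - 1 / (2 * (n : ℝ)))) ^ 2 := by
    rw [← Real.rpow_natCast, ← Real.rpow_mul ht0.le, one_div (t ^ _), ← Real.rpow_neg ht0.le]
    congr 1
    push_cast
    field_simp
    ring
  rw [hsq]
  gcongr
  linarith

theorem integral_rpow_from_one {a : ℝ} (ha1 : a ≠ 1) {s : ℝ} (hs : 1 ≤ s) :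
    ∫ t in (1 : ℝ)..s, t ^ (-(a + 1) / 2) = (s ^ ((1 - a) / 2) - 1) * (2 / (1 - a)) := by
  have h0 : 1 - a ≠ 0 := sub_ne_zero.2 ha1.symm
  rw [integral_rpow (Or.inr ⟨fun h => ha1 (by linarith), fun h => ?_⟩),
    show -(a + 1) / 2 + 1 = (1 - a) / 2 by ring, Real.one_rpow]
  · field_simp
  · rw [Set.uIcc_of_le hs] at h
    linarith [h.1]

theorem intervalIntegrable_rpow_from_one (p : ℝ) {s : ℝ} (hs : 1 ≤ s) :
    IntervalIntegrable (fun t : ℝ => t ^ p) MeasureTheory.volume 1 s := by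
  refine intervalIntegral.intervalIntegrable_rpow (Or.inr fun h => ?_)
  rw [Set.uIcc_of_le hs] at h
  linarith [h.1]

theorem rpow_half_rpow_neg {a : ℝ} (ha : 0 < a) {t : ℝ} (ht : 0 ≤ t) :
    (t ^ (a / 2)) ^ (-(1 + 1 / a)) = t ^ (-(a + 1) / 2) := by
  rw [← Real.rpow_mul ht]
  congr 1
  field_simp

theorem integral_one_add_rpow_le {a : ℝ} (ha : 0 < a) {s : ℝ} (hs : 0 ≤ s) :
    ∫ t in (0 : ℝ)..s, (1 + t ^ (a / 2)) ^ (-(1 + 1 / a)) ≤ s := by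
  have h : ∫ _ in (0 : ℝ)..s, (1 : ℝ) = s := by simp
  refine le_of_le_of_eq (intervalIntegral.integral_mono_on hs
    (intervalIntegrable_of_continuousOn_Ici (continuousOn_one_add_rpow_rpow ha _) le_rfl hs)
    intervalIntegrable_const fun t ht => ?_) h
  have := Real.rpow_nonneg ht.1 (a / 2)
  have : 0 < 1 / a := by positivity
  exact Real.rpow_le_one_of_one_le_of_nonpos (by linarith) (by linarith)

theorem integral_one_add_rpow_from_one_le {a : ℝ} (ha : 0 < a) (ha1 : a ≠ 1) {s : ℝ}
    (hs : 1 ≤ s) :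
    ∫ t in (1 : ℝ)..s, (1 + t ^ (a / 2)) ^ (-(1 + 1 / a)) ≤
      (s ^ ((1 - a) / 2) - 1) * (2 / (1 - a)) := by
  rw [← integral_rpow_from_one ha1 hs]
  refine intervalIntegral.integral_mono_on hs
    (intervalIntegrable_of_continuousOn_Ici (continuousOn_one_add_rpow_rpow ha _) zero_le_one
      (zero_le_one.trans hs))
    (intervalIntegrable_rpow_from_one _ hs) fun t ht => ?_
  have ht0 : 0 < t := by linarith [ht.1]
  rw [← rpow_half_rpow_neg ha ht0.le]
  have : 0 < 1 / a := by positivity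
  exact Real.rpow_le_rpow_of_nonpos (Real.rpow_pos_of_pos ht0 _) (by linarith) (by linarith)

theorem le_integral_one_add_rpow_from_one {a : ℝ} (ha : 0 < a) (ha1 : a ≠ 1) {s : ℝ}
    (hs : 1 ≤ s) :
    2 ^ (-(1 + 1 / a)) * ((s ^ ((1 - a) / 2) - 1) * (2 / (1 - a))) ≤
      ∫ t in (1 : ℝ)..s, (1 + t ^ (a / 2)) ^ (-(1 + 1 / a)) := by
  rw [← integral_rpow_from_one ha1 hs, ← intervalIntegral.integral_const_mul]
  refine intervalIntegral.integral_mono_on hs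
    ((intervalIntegrable_rpow_from_one _ hs).const_mul _)
    (intervalIntegrable_of_continuousOn_Ici (continuousOn_one_add_rpow_rpow ha _) zero_le_one
      (zero_le_one.trans hs)) fun t ht => ?_
  have ht0 : 0 < t := by linarith [ht.1]
  have hp : 0 < t ^ (a / 2) := Real.rpow_pos_of_pos ht0 _
  have hp1 : 1 ≤ t ^ (a / 2) := Real.one_le_rpow ht.1 (by positivity)
  rw [← rpow_half_rpow_neg ha ht0.le, ← Real.mul_rpow (by norm_num) hp.le]
  have : 0 < 1 / a := by positivity
  exact Real.rpow_le_rpow_of_nonpos (by linarith) (by linarith) (by linarith)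

theorem integral_one_add_rpow_nonneg (a : ℝ) {s : ℝ} (hs : 0 ≤ s) :
    0 ≤ ∫ t in (0 : ℝ)..s, (1 + t ^ (a / 2)) ^ (-(1 + 1 / a)) :=
  intervalIntegral.integral_nonneg hs fun t ht => by
    have := Real.rpow_nonneg ht.1 (a / 2)
    positivity

theorem integral_one_add_rpow_split {a : ℝ} (ha : 0 < a) {s : ℝ} (hs : 0 ≤ s) :
    ∫ t in (0 : ℝ)..s, (1 + t ^ (a / 2)) ^ (-(1 + 1 / a)) =
      (∫ t in (0 : ℝ)..1, (1 + t ^ (a / 2)) ^ (-(1 + 1 / a))) +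
        ∫ t in (1 : ℝ)..s, (1 + t ^ (a / 2)) ^ (-(1 + 1 / a)) :=
  (intervalIntegral.integral_add_adjacent_intervals
    (intervalIntegrable_of_continuousOn_Ici (continuousOn_one_add_rpow_rpow ha _)
      le_rfl zero_le_one)
    (intervalIntegrable_of_continuousOn_Ici (continuousOn_one_add_rpow_rpow ha _)
      zero_le_one hs)).symm

/-- Assume `a > 0`, `a ≠ 1`. There exist positive constants `c_a`
and `C_a`, depending only on `a`, such that for every integer `n ≥ 2` and every
`s ≥ 0`:
`c_a (s^{(1−a)/2} 𝟙_{s≥1} − 1) ≤ h_n(s) ≤ C_a (s^{1/n} + s^{(1−a)/2} 𝟙_{s≥1} + 1)`. -/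
theorem stmt_9 {a : ℝ} (ha : 0 < a) (ha1 : a ≠ 1) :
    ∃ c C : ℝ, 0 < c ∧ 0 < C ∧ ∀ n : ℕ, 2 ≤ n → ∀ s : ℝ, 0 ≤ s →
      c * (s ^ ((1 - a) / 2) * (if 1 ≤ s then (1 : ℝ) else 0) - 1) ≤ hfun a n s ∧
      hfun a n s ≤
        C * (s ^ (1 / (n : ℝ)) + s ^ ((1 - a) / 2) * (if 1 ≤ s then (1 : ℝ) else 0) + 1) := by
  have hd : 0 < |1 - a| := abs_pos.2 (sub_ne_zero.2 ha1.symm)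
  have hK : (0 : ℝ) < 2 ^ (-(1 + 1 / a)) := by positivity
  refine ⟨2 ^ (-(1 + 1 / a)) * (2 / |1 - a|), 1 + 2 / |1 - a|, by positivity, by positivity,
    fun n hn s hs => ?_⟩
  have hq : 0 < 2 / |1 - a| := by positivity
  have hR := integral_rational_term_nonneg n hs
  have hR' := integral_rational_term_le hn hs
  have hJ := integral_one_add_rpow_nonneg a hs
  have hsn : 0 ≤ s ^ (1 / (n : ℝ)) := Real.rpow_nonneg hs _
  rw [hfun_eq_add ha hn hs]
  by_cases h1 : 1 ≤ s
  · have hsp : 0 ≤ s ^ ((1 - a) / 2) := Real.rpow_nonneg hs _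
    have hsplit := integral_one_add_rpow_split ha hs
    have h01 := integral_one_add_rpow_le ha zero_le_one
    have h01' := integral_one_add_rpow_nonneg a zero_le_one
    have hup := integral_one_add_rpow_from_one_le ha ha1 h1
    have hlo := le_integral_one_add_rpow_from_one ha ha1 h1
    simp only [if_pos h1, mul_one]
    constructor
    · rcases lt_or_gt_of_ne ha1 with h | h
      · rw [abs_of_pos (by linarith : 0 < 1 - a)]
        linarith
      · have hle : s ^ ((1 - a) / 2) ≤ 1 :=
          Real.rpow_le_one_of_one_le_of_nonpos h1 (by linarith)
        exact (mul_nonpos_of_nonneg_of_nonpos (by positivity) (by linarith)).trans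
          (add_nonneg hJ hR)
    · have hbd : (s ^ ((1 - a) / 2) - 1) * (2 / (1 - a)) ≤
          (s ^ ((1 - a) / 2) + 1) * (2 / |1 - a|) := by
        refine (le_abs_self _).trans ?_
        rw [abs_mul, abs_div, abs_two]
        gcongr
        exact abs_le.2 ⟨by linarith, by linarith⟩
      nlinarith [mul_nonneg hq.le hsn]
  · have hJ' := integral_one_add_rpow_le ha hs
    simp only [if_neg h1, mul_zero, zero_sub, add_zero]
    constructor
    · linarith [mul_pos hK hq]
    · nlinarith [mul_nonneg hq.le hsn]
end

section
/- For every T ∈ ℝ^{d×d}, the Fenchel–Young inequality holds with equality at the gradient of f_α: f_α(T) + f_α*((1/α) F(T)) = ((1/α) F(T)) : T, where f_α*(S) = sup_{R ∈ ℝ^{d×d}} ( S : R − f_α(R) ) is the convex conjugate of f_α. -/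
open scoped RealInnerProductSpace

/-- `f_α(T) = (1/α) ∫₀^{|T|} t (1+t^a)^{-1/a} dt`. -/
noncomputable def falpha (d : ℕ) (a α : ℝ) (T : EuclideanSpace ℝ (Fin d × Fin d)) : ℝ :=
  (1 / α) * ∫ t in (0 : ℝ)..‖T‖, t * (1 + t ^ a) ^ (-(1 / a))

theorem monotoneOn_mul_one_add_rpow {a : ℝ} (ha : 0 < a) :
    MonotoneOn (fun t : ℝ => t * (1 + t ^ a) ^ (-(1 / a))) (Set.Ici 0) := by
  intro s hs t ht hst
  rw [Set.mem_Ici] at hs ht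
  have hsa : 0 ≤ s ^ a := Real.rpow_nonneg hs a
  have hta : 0 ≤ t ^ a := Real.rpow_nonneg ht a
  have hle : s ^ a ≤ t ^ a := Real.rpow_le_rpow hs hst ha.le
  have hpow : (s ^ a * (1 + t ^ a)) ^ (1 / a) ≤ (t ^ a * (1 + s ^ a)) ^ (1 / a) :=
    Real.rpow_le_rpow (by positivity) (by nlinarith) (by positivity)
  rw [Real.mul_rpow hsa (by positivity), Real.mul_rpow hta (by positivity),
    ← Real.rpow_mul hs, ← Real.rpow_mul ht, mul_one_div_cancel ha.ne', Real.rpow_one,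
    Real.rpow_one] at hpow
  dsimp only
  rw [Real.rpow_neg (by positivity), Real.rpow_neg (by positivity), ← div_eq_mul_inv,
    ← div_eq_mul_inv, div_le_div_iff₀ (by positivity) (by positivity)]
  exact hpow

/-- The integral of a monotone function lies above the tangent line at any point. -/
theorem MonotoneOn.mul_sub_le_intervalIntegral {g : ℝ → ℝ} (hg : MonotoneOn g (Set.Ici 0))
    {x y : ℝ} (hx : 0 ≤ x) (hy : 0 ≤ y) : g x * (y - x) ≤ ∫ t in x..y, g t := by
  have hint : IntervalIntegrable g MeasureTheory.volume x y :=
    (hg.mono fun t ht => (le_min hx hy).trans ht.1).intervalIntegrable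
  rcases le_total x y with h | h
  · have := intervalIntegral.integral_mono_on h intervalIntegrable_const hint
      (fun t ht => hg hx (hx.trans ht.1) ht.1)
    rw [intervalIntegral.integral_const, smul_eq_mul] at this
    linarith
  · have := intervalIntegral.integral_mono_on h hint.symm intervalIntegrable_const
      (fun t ht => hg (hy.trans ht.1) hx ht.2)
    rw [intervalIntegral.integral_const, smul_eq_mul] at this
    rw [intervalIntegral.integral_symm]
    linarith

/-- `(1/α) F(T)` is a subgradient of `f_α` at `T`. -/
theorem inner_matF_sub_falpha_le {d : ℕ} {a α : ℝ} (ha : 0 < a) (hα : 0 < α)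
    (T R : EuclideanSpace ℝ (Fin d × Fin d)) :
    ⟪(1 / α) • matF d a T, R⟫ - falpha d a α R ≤
      ⟪(1 / α) • matF d a T, T⟫ - falpha d a α T := by
  have hmono := monotoneOn_mul_one_add_rpow ha
  have hint : ∀ y : ℝ, 0 ≤ y → IntervalIntegrable
      (fun t : ℝ => t * (1 + t ^ a) ^ (-(1 / a))) MeasureTheory.volume 0 y := fun y hy =>
    (hmono.mono fun t ht => (le_min le_rfl hy).trans ht.1).intervalIntegrable
  have htan := hmono.mul_sub_le_intervalIntegral (norm_nonneg T) (norm_nonneg R)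
  rw [← intervalIntegral.integral_interval_sub_left (hint _ (norm_nonneg R))
    (hint _ (norm_nonneg T))] at htan
  have hc : 0 ≤ (1 + ‖T‖ ^ a) ^ (-(1 / a)) := by positivity
  have hcs := mul_le_mul_of_nonneg_left (real_inner_le_norm T R) hc
  simp only [matF, falpha, real_inner_smul_left, real_inner_self_eq_norm_sq, ← mul_sub]
  refine mul_le_mul_of_nonneg_left ?_ (by positivity)
  linarith

/-- For every `T ∈ ℝ^{d×d}`, the Fenchel–Young inequality holds
with equality at the gradient of `f_α`:
`f_α(T) + f_α*((1/α) F(T)) = ((1/α) F(T)) : T`, where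
`f_α*(S) = sup_R (S : R − f_α(R))` is the convex conjugate (computed in the
extended reals). -/
theorem stmt_15 {d : ℕ} (hd : 1 ≤ d) {a α : ℝ} (ha : 0 < a) (hα : 0 < α)
    (T : EuclideanSpace ℝ (Fin d × Fin d)) :
    ((falpha d a α T : ℝ) : EReal) +
      (⨆ R : EuclideanSpace ℝ (Fin d × Fin d),
        ((⟪(1 / α) • matF d a T, R⟫ - falpha d a α R : ℝ) : EReal)) =
      ((⟪(1 / α) • matF d a T, T⟫ : ℝ) : EReal) := by
  have hsup : (⨆ R : EuclideanSpace ℝ (Fin d × Fin d),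
      ((⟪(1 / α) • matF d a T, R⟫ - falpha d a α R : ℝ) : EReal)) =
      ((⟪(1 / α) • matF d a T, T⟫ - falpha d a α T : ℝ) : EReal) :=
    le_antisymm
      (iSup_le fun R => EReal.coe_le_coe_iff.2 (inner_matF_sub_falpha_le ha hα T R))
      (le_iSup (fun R : EuclideanSpace ℝ (Fin d × Fin d) =>
        ((⟪(1 / α) • matF d a T, R⟫ - falpha d a α R : ℝ) : EReal)) T)
  rw [hsup, ← EReal.coe_add, add_sub_cancel]
end

section
/- Let C_a = max{1, 2^{−1+1/a}}. For every integer n ≥ 2 and every T ∈ ℝ^{d×d}, the coercivity bound T : F_n(T) ≥ (|T| − 1)/C_a + (|T|^{1+1/n} − 1)/(2n) holds. -/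
open scoped RealInnerProductSpace

/-- The comparison `(1 + t^a)^{1/a} ≤ max {1, 2^{-1+1/a}} (1 + t)`. -/
theorem one_add_rpow_rpow_inv_le {a t : ℝ} (ha : 0 < a) (ht : 0 ≤ t) :
    (1 + t ^ a) ^ (1 / a) ≤ max 1 ((2 : ℝ) ^ (-1 + 1 / a)) * (1 + t) := by
  have hta : 0 ≤ t ^ a := Real.rpow_nonneg ht a
  have hpow : (t ^ a) ^ (1 / a) = t := by
    rw [← Real.rpow_mul ht, mul_one_div_cancel ha.ne', Real.rpow_one]
  rcases le_total 1 a with h | h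
  · have h1 : 1 / a ≤ 1 := (div_le_one ha).2 h
    have key := Real.rpow_add_le_add_rpow zero_le_one hta (one_div_nonneg.2 ha.le) h1
    rw [hpow, Real.one_rpow] at key
    exact key.trans (le_mul_of_one_le_left (by linarith) (le_max_left _ _))
  · have h1 : 1 ≤ 1 / a := (one_le_div ha).2 h
    have key := NNReal.rpow_add_le_mul_rpow_add_rpow 1 ⟨t ^ a, hta⟩ h1
    replace key : (1 + t ^ a) ^ (1 / a) ≤
        2 ^ (1 / a - 1) * (1 ^ (1 / a) + (t ^ a) ^ (1 / a)) := by exact_mod_cast key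
    rw [hpow, Real.one_rpow, sub_eq_neg_add] at key
    exact key.trans (mul_le_mul_of_nonneg_right (le_max_right _ _) (by linarith))

/-- Coercivity of the radial part of `matF`. -/
theorem sub_one_div_le_rpow_mul_sq {a t : ℝ} (ha : 0 < a) (ht : 0 ≤ t) :
    (t - 1) / max 1 ((2 : ℝ) ^ (-1 + 1 / a)) ≤ (1 + t ^ a) ^ (-(1 / a)) * t ^ 2 := by
  have hle := one_add_rpow_rpow_inv_le ha ht
  have hbase : 0 < 1 + t ^ a := by positivity
  have hpos : 0 < (1 + t ^ a) ^ (1 / a) := Real.rpow_pos_of_pos hbase _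
  set C := max 1 ((2 : ℝ) ^ (-1 + 1 / a))
  have hC : 0 < C := lt_max_of_lt_left one_pos
  rw [Real.rpow_neg hbase.le, inv_mul_eq_div]
  calc (t - 1) / C ≤ t ^ 2 / (C * (1 + t)) := by
        rw [div_le_div_iff₀ hC (by positivity)]
        nlinarith
    _ ≤ t ^ 2 / (1 + t ^ a) ^ (1 / a) := by gcongr

/-- Coercivity of the radial part of the regularisation, for a general exponent `r` in place
of `1 / n`. -/
theorem rpow_one_add_sub_one_div_two_le {r t : ℝ} (hr₀ : 0 ≤ r) (hr₁ : r ≤ 1) (ht : 0 ≤ t) :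
    (t ^ (1 + r) - 1) / 2 ≤ t ^ 2 / (1 + t ^ (1 - r)) := by
  have hs : 0 ≤ t ^ (1 - r) := Real.rpow_nonneg ht _
  have hu : 0 ≤ t ^ (1 + r) := Real.rpow_nonneg ht _
  have hmul : t ^ (1 + r) * t ^ (1 - r) = t ^ 2 := by
    rw [← Real.rpow_add_of_nonneg ht (by linarith) (by linarith), ← Real.rpow_natCast]
    norm_num
  rw [div_le_div_iff₀ two_pos (by linarith), ← hmul]
  rcases le_total t 1 with h | h
  · have := Real.rpow_le_one ht h (by linarith : 0 ≤ 1 + r)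
    nlinarith [mul_nonneg hu hs]
  · have := Real.one_le_rpow h (by linarith : 0 ≤ 1 - r)
    nlinarith

/-- Let `C_a = max {1, 2^{−1+1/a}}`. For every integer `n ≥ 2`
and every `T ∈ ℝ^{d×d}`, the coercivity bound
`T : F_n(T) ≥ (|T| − 1)/C_a + (|T|^{1+1/n} − 1)/(2n)` holds. -/
theorem stmt_16 {d : ℕ} (hd : 1 ≤ d) {a : ℝ} (ha : 0 < a) (n : ℕ) (hn : 2 ≤ n)
    (T : EuclideanSpace ℝ (Fin d × Fin d)) :
    (‖T‖ - 1) / max 1 ((2 : ℝ) ^ (-1 + 1 / a)) +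
        (‖T‖ ^ (1 + 1 / (n : ℝ)) - 1) / (2 * (n : ℝ)) ≤ ⟪T, matFn d a n T⟫ := by
  have hn₀ : (0 : ℝ) < n := by positivity
  have hn₁ : (1 : ℝ) ≤ n := by exact_mod_cast one_le_two.trans hn
  have hreg := rpow_one_add_sub_one_div_two_le (one_div_nonneg.2 hn₀.le)
    ((div_le_one hn₀).2 hn₁) (norm_nonneg T)
  rw [matFn, matF, inner_add_right, real_inner_smul_right, real_inner_smul_right,
    real_inner_self_eq_norm_sq]
  refine add_le_add (sub_one_div_le_rpow_mul_sq ha (norm_nonneg T)) ?_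
  rw [inv_mul_eq_div, ← div_div, mul_comm (n : ℝ), ← div_div]
  exact (div_le_div_of_nonneg_right hreg hn₀.le).trans_eq (by rw [div_div])
end
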